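/- Let A be an integral local ring with maximal ideal m and fraction field K. For all a, b, c ∈ A and s, t ∈ m the following identities hold in K^M_2(K): (1) {1+as, 1+bt} = −{1 + (ab/(1+as))st, −as(1+bt)}; (2) {1 + ((s−1)/(1+ct))·ct, 1 − ((1+ct)/(1+cst))·s} = {1+cst, s} (whenever the entries of the symbols are units of K, which is automatic for (1)). -/

import Mathlib

/-!
# Statement 8 (Rülling–Saito, Lemma `lem:symbol-formula`)

Let `A` be an integral local ring with maximal ideal `m` and fraction field `K`.
For `a, b, c ∈ A` and `s, t ∈ m` the following hold in `K^M_2(K)`: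
1. `{1+as, 1+bt} = −{1 + (ab/(1+as))·st, −as(1+bt)}`;
2. `{1 + ((s−1)/(1+ct))·ct, 1 − ((1+ct)/(1+cst))·s} = {1+cst, s}`,
whenever the entries of the symbols are units of `K` (automatic for (1)).
-/

open scoped Classical

namespace RuellingSaito

/-- The subgroup of relations defining the `r`-th Milnor K-group of a commutative ring `F`:
multilinearity in each entry and the Steinberg relation for adjacent entries
(`a i + a (i+1) = 1`). -/
def milnorRel (F : Type) [CommRing F] (r : ℕ) :
    AddSubgroup (FreeAbelianGroup (Fin r → Fˣ)) :=
  AddSubgroup.closure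
    ({x | ∃ (a b : Fin r → Fˣ) (i : Fin r), (∀ j, j ≠ i → a j = b j) ∧
        x = FreeAbelianGroup.of (Function.update a i (a i * b i)) -
            FreeAbelianGroup.of a - FreeAbelianGroup.of b} ∪
     {x | ∃ (a : Fin r → Fˣ) (i j : Fin r), (i : ℕ) + 1 = (j : ℕ) ∧
        ((a i : F) + (a j : F) = 1) ∧ x = FreeAbelianGroup.of a})

/-- The `r`-th Milnor K-group of a commutative ring `F`: the quotient of the `r`-fold
tensor power of `Fˣ` (presented as a free abelian group modulo multilinearity) by the
Steinberg relations. -/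
abbrev MilnorK (r : ℕ) (F : Type) [CommRing F] : Type :=
  FreeAbelianGroup (Fin r → Fˣ) ⧸ milnorRel F r

/-- The Milnor symbol `{a 0, …, a (r-1)}`. -/
def MilnorK.symbol {F : Type} [CommRing F] {r : ℕ} (a : Fin r → Fˣ) : MilnorK r F :=
  QuotientAddGroup.mk (FreeAbelianGroup.of a)

namespace MilnorK

variable {F : Type}

theorem symbol_mul_left [CommRing F] (x y z : Fˣ) :
    symbol ![x * y, z] = symbol ![x, z] + symbol ![y, z] := by
  have h : FreeAbelianGroup.of ![x * y, z] - FreeAbelianGroup.of ![x, z] -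
      FreeAbelianGroup.of ![y, z] ∈ milnorRel F 2 := by
    refine AddSubgroup.subset_closure (Or.inl ⟨![x, z], ![y, z], 0, ?_, ?_⟩)
    · intro j hj
      fin_cases j <;> simp_all
    · congr 3
      ext j
      fin_cases j <;> simp
  have h' := (QuotientAddGroup.eq_zero_iff _).2 h
  rw [QuotientAddGroup.mk_sub, QuotientAddGroup.mk_sub, sub_sub, sub_eq_zero] at h'
  exact h'

theorem symbol_mul_right [CommRing F] (x y z : Fˣ) :
    symbol ![x, y * z] = symbol ![x, y] + symbol ![x, z] := by
  have h : FreeAbelianGroup.of ![x, y * z] - FreeAbelianGroup.of ![x, y] -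
      FreeAbelianGroup.of ![x, z] ∈ milnorRel F 2 := by
    refine AddSubgroup.subset_closure (Or.inl ⟨![x, y], ![x, z], 1, ?_, ?_⟩)
    · intro j hj
      fin_cases j <;> simp_all
    · congr 3
      ext j
      fin_cases j <;> simp
  have h' := (QuotientAddGroup.eq_zero_iff _).2 h
  rw [QuotientAddGroup.mk_sub, QuotientAddGroup.mk_sub, sub_sub, sub_eq_zero] at h'
  exact h'

theorem symbol_eq_zero_of_add_eq_one [CommRing F] {x y : Fˣ} (h : (x : F) + y = 1) :
    symbol ![x, y] = 0 :=
  (QuotientAddGroup.eq_zero_iff _).2 <|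
    AddSubgroup.subset_closure (Or.inr ⟨![x, y], 0, 1, rfl, h, rfl⟩)

theorem symbol_one_left [CommRing F] (x : Fˣ) : symbol ![1, x] = 0 := by
  simpa using symbol_mul_left 1 1 x

theorem symbol_inv_left [CommRing F] (x y : Fˣ) : symbol ![x⁻¹, y] = -symbol ![x, y] := by
  rw [eq_neg_iff_add_eq_zero, ← symbol_mul_left, inv_mul_cancel, symbol_one_left]

variable [Field F]

theorem symbol_neg_self (x : Fˣ) : symbol ![x, -x] = 0 := by
  by_cases hx : (x : F) = 1
  · rw [Units.val_eq_one.1 hx, symbol_one_left]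
  have hx0 : (x : F) ≠ 0 := x.ne_zero
  let y : Fˣ := Units.mk0 (1 - x) (sub_ne_zero.2 (Ne.symm hx))
  let z : Fˣ := Units.mk0 (1 - (x : F)⁻¹) (sub_ne_zero.2 fun h => hx (inv_eq_one.1 h.symm))
  have hy : symbol ![x, y] = 0 := symbol_eq_zero_of_add_eq_one (by simp [y])
  have hz : symbol ![x, z] = 0 := by
    rw [← neg_eq_zero, ← symbol_inv_left]
    exact symbol_eq_zero_of_add_eq_one (by simp [z])
  have hyz : y = -x * z := by
    ext
    simp only [y, z, Units.val_mk0, Units.val_mul, Units.val_neg]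
    field_simp
    ring
  rwa [hyz, symbol_mul_right, hz, add_zero] at hy

theorem symbol_swap (x y : Fˣ) : symbol ![x, y] = -symbol ![y, x] := by
  have h := symbol_neg_self (x * y)
  have hx : symbol ![x, -(x * y)] = symbol ![x, y] := by
    rw [← neg_mul, symbol_mul_right, symbol_neg_self, zero_add]
  have hy : symbol ![y, -(x * y)] = symbol ![y, x] := by
    rw [mul_comm, ← neg_mul, symbol_mul_right, symbol_neg_self, zero_add]
  rw [symbol_mul_left, hx, hy] at h
  exact eq_neg_of_add_eq_zero_left h

end MilnorK

/-- Milnor `K₂` identities for an integral local ring `A` with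
maximal ideal `m` and fraction field `K`. The elements occurring as entries of the
symbols are given as units of `K` together with equations specifying their values. -/
theorem milnorK2_symbol_identities
    (A : Type) [CommRing A] [IsDomain A] [IsLocalRing A]
    (K : Type) [Field K] [Algebra A K] [IsFractionRing A K]
    (a b c : A) (s t : A)
    (hs : s ∈ IsLocalRing.maximalIdeal A) (ht : t ∈ IsLocalRing.maximalIdeal A) :
    -- (1)  {1+as, 1+bt} = −{1 + (ab/(1+as))·st, −as·(1+bt)}
    (∀ u₁ u₂ v₁ v₂ : Kˣ,
      (u₁ : K) = 1 + algebraMap A K a * algebraMap A K s →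
      (u₂ : K) = 1 + algebraMap A K b * algebraMap A K t →
      (v₁ : K) = 1 + (algebraMap A K a * algebraMap A K b) /
          (1 + algebraMap A K a * algebraMap A K s) *
          (algebraMap A K s * algebraMap A K t) →
      (v₂ : K) = -(algebraMap A K a * algebraMap A K s) *
          (1 + algebraMap A K b * algebraMap A K t) →
      MilnorK.symbol ![u₁, u₂] = - MilnorK.symbol ![v₁, v₂]) ∧
    -- (2)  {1 + ((s−1)/(1+ct))·ct, 1 − ((1+ct)/(1+cst))·s} = {1+cst, s}
    (∀ w₁ w₂ w₃ w₄ : Kˣ,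
      (w₁ : K) = 1 + (algebraMap A K s - 1) / (1 + algebraMap A K c * algebraMap A K t) *
          (algebraMap A K c * algebraMap A K t) →
      (w₂ : K) = 1 - (1 + algebraMap A K c * algebraMap A K t) /
          (1 + algebraMap A K c * algebraMap A K s * algebraMap A K t) * algebraMap A K s →
      (w₃ : K) = 1 + algebraMap A K c * algebraMap A K s * algebraMap A K t →
      (w₄ : K) = algebraMap A K s →
      MilnorK.symbol ![w₁, w₂] = MilnorK.symbol ![w₃, w₄]) := by
  constructor
  · intro u₁ u₂ v₁ v₂ hu₁ hu₂ hv₁ hv₂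
    have hu₁0 := hu₁ ▸ u₁.ne_zero
    have hst : (↑(u₁ * v₁) : K) + v₂ = 1 := by
      rw [Units.val_mul, hu₁, hv₁, hv₂]
      field_simp
      ring
    obtain ⟨w, rfl⟩ : ∃ w, v₂ = w * u₂ := ⟨v₂ * u₂⁻¹, by simp⟩
    have hw : (u₁ : K) + w = 1 := by
      rw [Units.val_mul, ← hu₂] at hv₂
      rw [mul_right_cancel₀ u₂.ne_zero hv₂, hu₁]
      ring
    have h := MilnorK.symbol_eq_zero_of_add_eq_one hst
    rw [MilnorK.symbol_mul_left, MilnorK.symbol_mul_right u₁,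
      MilnorK.symbol_eq_zero_of_add_eq_one hw, zero_add] at h
    exact eq_neg_of_add_eq_zero_left h
  · intro w₁ w₂ w₃ w₄ hw₁ hw₂ hw₃ hw₄
    have hct : 1 + algebraMap A K c * algebraMap A K t ≠ 0 := by
      rw [← map_mul, ← map_one (algebraMap A K), ← map_add, Ne,
        IsFractionRing.to_map_eq_zero_iff]
      intro h
      refine (IsLocalRing.maximalIdeal.isMaximal A).ne_top ((Ideal.eq_top_iff_one _).2 ?_)
      rw [eq_neg_of_add_eq_zero_left h]
      exact neg_mem (Ideal.mul_mem_left _ c ht)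
    have hw₂' : (w₂ : K) * w₃ = 1 - w₄ := by
      rw [hw₂, ← hw₃, hw₄]
      field_simp
      rw [hw₃]
      ring
    have hst : (↑(w₁⁻¹ * w₄) : K) + w₂ = 1 := by
      have h₁ := w₁.ne_zero
      have h₃ := w₃.ne_zero
      rw [Units.val_mul, Units.val_inv_eq_inv_val]
      field_simp
      refine mul_right_cancel₀ h₃ ?_
      have h : (w₁ : K) * (1 - w₄) = w₁ * w₃ - w₃ * w₄ := by
        rw [hw₁, hw₃, hw₄]
        field_simp
        ring
      linear_combination (w₁ : K) * hw₂' + h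
    have hst' : (w₄ : K) + ↑(w₂ * w₃) = 1 := by
      rw [Units.val_mul, hw₂', add_sub_cancel]
    have h := MilnorK.symbol_eq_zero_of_add_eq_one hst
    have h' := MilnorK.symbol_eq_zero_of_add_eq_one hst'
    rw [MilnorK.symbol_mul_left, MilnorK.symbol_inv_left, neg_add_eq_zero] at h
    rw [MilnorK.symbol_mul_right] at h'
    rw [h, MilnorK.symbol_swap w₃, eq_neg_iff_add_eq_zero, h']

end RuellingSaito
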